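/- arXiv:2301.08075 — 3 statements merged into one kernel-verified Lean document; each statement's English description precedes it below -/
import Mathlib

section
/- Let D > 1, L > 0 and A₁, B₁ ∈ ℝ with (A₁, B₁) ≠ (0, 0), and consider the solutions x** ∈ [0, L] of the Melnikov condition M(L − 2x**) = 0 (the case C₁ = 0). Then x** = L/2 is always a solution. Set B₁¹ = min(−D̃A₁, −A₁) and B₁² = max(−D̃A₁, −A₁). If B₁ ∈ (B₁¹, B₁²), there are exactly two further solutions in (0, L), symmetrically placed about L/2. If B₁ = −A₁ (and A₁ ≠ 0), the only further solutions are x** = 0 and x** = L. If B₁ = −D̃A₁ (and A₁ ≠ 0), then x** = L/2 is a root of multiplicity three of the function x ↦ M(L − 2x). If B₁ ∉ [B₁¹, B₁²], there are no solutions in [0, L] other than x** = L/2. -/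
open Real Set

/-- The Melnikov function `M(z) = A₁ sinh(z)/sinh(L) + B₁ sinh(z/D)/sinh(L/D)`. -/
noncomputable def Mel (A₁ B₁ D L z : ℝ) : ℝ :=
  A₁ * Real.sinh z / Real.sinh L + B₁ * Real.sinh (z / D) / Real.sinh (L / D)

/-- `D̃ = D sinh(L/D)/sinh(L)`. -/
noncomputable def Dtil (D L : ℝ) : ℝ := D * Real.sinh (L / D) / Real.sinh L

/-- The set of solutions `x** ∈ [0, L]` of the Melnikov condition `M(L − 2x**) = 0`
(the case `C₁ = 0`). -/
noncomputable def MelSolSet (A₁ B₁ D L : ℝ) : Set ℝ :=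
  {x | x ∈ Set.Icc 0 L ∧ Mel A₁ B₁ D L (L - 2 * x) = 0}

/-- The continuous extension to `z = 0` of the ratio `sinh z / (D sinh (z / D))`. -/
noncomputable def sinhRatio (D z : ℝ) : ℝ :=
  dslope Real.sinh 0 z / dslope Real.sinh 0 (z / D)

lemma dslope_sinh_of_ne {z : ℝ} (hz : z ≠ 0) : dslope Real.sinh 0 z = Real.sinh z / z := by
  simp [dslope_of_ne _ hz, slope_def_field]

lemma dslope_sinh_ne_zero (z : ℝ) : dslope Real.sinh 0 z ≠ 0 := by
  rcases eq_or_ne z 0 with rfl | hz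
  · simp
  · rw [dslope_sinh_of_ne hz]
    exact div_ne_zero (Real.sinh_ne_zero.2 hz) hz

lemma continuous_dslope_sinh : Continuous (dslope Real.sinh 0) := by
  rw [continuous_iff_continuousAt]
  intro z
  rcases eq_or_ne z 0 with rfl | hz
  · exact continuousAt_dslope_same.2 Real.differentiable_sinh.differentiableAt
  · exact (continuousAt_dslope_of_ne hz).2 Real.continuous_sinh.continuousAt

lemma continuous_sinhRatio (D : ℝ) : Continuous (sinhRatio D) :=
  continuous_dslope_sinh.div (continuous_dslope_sinh.comp (continuous_id.div_const D))
    fun _ => dslope_sinh_ne_zero _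

lemma sinhRatio_zero (D : ℝ) : sinhRatio D 0 = 1 := by
  simp [sinhRatio]

lemma sinhRatio_of_ne {D z : ℝ} (hD : D ≠ 0) (hz : z ≠ 0) :
    sinhRatio D z = Real.sinh z / (D * Real.sinh (z / D)) := by
  have hzD : z / D ≠ 0 := div_ne_zero hz hD
  have hs : Real.sinh (z / D) ≠ 0 := Real.sinh_ne_zero.2 hzD
  rw [sinhRatio, dslope_sinh_of_ne hz, dslope_sinh_of_ne hzD]
  field_simp

lemma sinhRatio_neg {D : ℝ} (hD : D ≠ 0) (z : ℝ) : sinhRatio D (-z) = sinhRatio D z := by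
  rcases eq_or_ne z 0 with rfl | hz
  · simp
  · rw [sinhRatio_of_ne hD hz, sinhRatio_of_ne hD (neg_ne_zero.2 hz), neg_div, Real.sinh_neg,
      Real.sinh_neg, mul_neg, neg_div_neg_eq]

lemma sinhRatio_abs {D : ℝ} (hD : D ≠ 0) (z : ℝ) : sinhRatio D |z| = sinhRatio D z := by
  rcases abs_choice z with h | h <;> rw [h]
  exact sinhRatio_neg hD z

lemma sinh_mul_cosh_div_lt {D z : ℝ} (hD : 1 < D) (hz : 0 < z) :
    Real.sinh z * Real.cosh (z / D) < D * (Real.cosh z * Real.sinh (z / D)) := by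
  have hD0 : 0 < D := by linarith
  let g : ℝ → ℝ := fun t =>
    D * (Real.cosh t * Real.sinh (t / D)) - Real.sinh t * Real.cosh (t / D)
  have hg : ∀ t, HasDerivAt g ((D - 1 / D) * (Real.sinh t * Real.sinh (t / D))) t := by
    intro t
    have hd : HasDerivAt (fun t : ℝ => t / D) (1 / D) t := (hasDerivAt_id t).div_const D
    have h := (((Real.hasDerivAt_cosh t).mul hd.sinh).const_mul D).sub
      ((Real.hasDerivAt_sinh t).mul hd.cosh)
    refine h.congr_deriv ?_
    field_simp
    ring
  have hmono : StrictMonoOn g (Set.Ici 0) := by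
    refine strictMonoOn_of_deriv_pos (convex_Ici 0)
      (fun t _ => (hg t).continuousAt.continuousWithinAt) fun t ht => ?_
    rw [interior_Ici, Set.mem_Ioi] at ht
    rw [(hg t).deriv]
    have h1 : 1 / D < D := by rw [div_lt_iff₀ hD0]; nlinarith
    exact mul_pos (sub_pos.2 h1)
      (mul_pos (Real.sinh_pos_iff.2 ht) (Real.sinh_pos_iff.2 (div_pos ht hD0)))
  have h := hmono Set.self_mem_Ici (Set.mem_Ici.2 hz.le) hz
  simpa [g] using h

lemma strictMonoOn_sinhRatio {D : ℝ} (hD : 1 < D) : StrictMonoOn (sinhRatio D) (Set.Ici 0) := by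
  have hD0 : 0 < D := by linarith
  refine strictMonoOn_of_deriv_pos (convex_Ici 0) (continuous_sinhRatio D).continuousOn
    fun z hz => ?_
  rw [interior_Ici, Set.mem_Ioi] at hz
  have hs : 0 < Real.sinh (z / D) := Real.sinh_pos_iff.2 (div_pos hz hD0)
  have heq : sinhRatio D =ᶠ[nhds z] fun t => Real.sinh t / (D * Real.sinh (t / D)) := by
    filter_upwards [eventually_ne_nhds hz.ne'] with t ht using sinhRatio_of_ne hD0.ne' ht
  have hd : HasDerivAt (fun t : ℝ => t / D) (1 / D) z := (hasDerivAt_id z).div_const D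
  have h := (Real.hasDerivAt_sinh z).div (hd.sinh.const_mul D) (mul_pos hD0 hs).ne'
  rw [heq.deriv_eq]
  refine lt_of_lt_of_eq (div_pos ?_ (pow_pos (mul_pos hD0 hs) 2)) h.deriv.symm
  have hlt := sinh_mul_cosh_div_lt hD hz
  have hc : D * (Real.cosh (z / D) * (1 / D)) = Real.cosh (z / D) := by field_simp
  rw [hc]
  linarith

lemma Dtil_mul_sinhRatio {D L : ℝ} (hD : 0 < D) (hL : 0 < L) : Dtil D L * sinhRatio D L = 1 := by
  have h1 : Real.sinh L ≠ 0 := Real.sinh_ne_zero.2 hL.ne'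
  have h2 : Real.sinh (L / D) ≠ 0 := Real.sinh_ne_zero.2 (div_pos hL hD).ne'
  rw [Dtil, sinhRatio_of_ne hD.ne' hL.ne']
  field_simp

lemma Dtil_pos {D L : ℝ} (hD : 0 < D) (hL : 0 < L) : 0 < Dtil D L :=
  div_pos (mul_pos hD (Real.sinh_pos_iff.2 (div_pos hL hD))) (Real.sinh_pos_iff.2 hL)

lemma Mel_eq_zero_iff {A₁ B₁ D L z : ℝ} (hD : 0 < D) (hL : 0 < L) (hz : z ≠ 0) :
    Mel A₁ B₁ D L z = 0 ↔ B₁ = -(Dtil D L) * A₁ * sinhRatio D z := by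
  have h1 : Real.sinh L ≠ 0 := Real.sinh_ne_zero.2 hL.ne'
  have h2 : Real.sinh (L / D) ≠ 0 := Real.sinh_ne_zero.2 (div_pos hL hD).ne'
  have h3 : Real.sinh (z / D) ≠ 0 := Real.sinh_ne_zero.2 (div_ne_zero hz hD.ne')
  rw [Mel, Dtil, sinhRatio_of_ne hD.ne' hz]
  field_simp
  constructor <;> intro h <;> linarith

lemma half_mem_MelSolSet (A₁ B₁ D : ℝ) {L : ℝ} (hL : 0 < L) : L / 2 ∈ MelSolSet A₁ B₁ D L := by
  refine ⟨⟨by linarith, by linarith⟩, ?_⟩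
  simp [Mel, mul_div_cancel₀ L (two_ne_zero' ℝ)]

lemma MelSolSet_eq_of_sinhRatio {A₁ B₁ D L z : ℝ} (hD : 1 < D) (hA : A₁ ≠ 0) (hz : 0 < z)
    (hzL : z ≤ L) (hB : B₁ = -(Dtil D L) * A₁ * sinhRatio D z) :
    MelSolSet A₁ B₁ D L = {(L - z) / 2, L / 2, L - (L - z) / 2} := by
  have hD0 : 0 < D := by linarith
  have hL : 0 < L := hz.trans_le hzL
  ext x
  simp only [Set.mem_insert_iff, Set.mem_singleton_iff]
  constructor
  · rintro ⟨-, hx⟩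
    rcases eq_or_ne (L - 2 * x) 0 with h0 | h0
    · right; left; linarith
    rw [Mel_eq_zero_iff hD0 hL h0, hB] at hx
    have hr := mul_left_cancel₀
      (mul_ne_zero (neg_ne_zero.2 (Dtil_pos hD0 hL).ne') hA) hx
    rw [← sinhRatio_abs hD0.ne' (L - 2 * x)] at hr
    have hzx := (strictMonoOn_sinhRatio hD).injOn (Set.mem_Ici.2 hz.le)
      (Set.mem_Ici.2 (abs_nonneg _)) hr
    rcases abs_choice (L - 2 * x) with h | h <;> rw [h] at hzx
    · left; linarith
    · right; right; linarith
  · rintro (rfl | rfl | rfl)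
    · refine ⟨⟨by linarith, by linarith⟩, ?_⟩
      rw [show L - 2 * ((L - z) / 2) = z by ring, Mel_eq_zero_iff hD0 hL hz.ne']
      exact hB
    · exact half_mem_MelSolSet A₁ B₁ D hL
    · refine ⟨⟨by linarith, by linarith⟩, ?_⟩
      rw [show L - 2 * (L - (L - z) / 2) = -z by ring,
        Mel_eq_zero_iff hD0 hL (neg_ne_zero.2 hz.ne'), sinhRatio_neg hD0.ne']
      exact hB

lemma mem_uIcc_of_Mel_eq_zero {A₁ B₁ D L z : ℝ} (hD : 1 < D) (hL : 0 < L) (hz : z ≠ 0)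
    (hzL : |z| ≤ L) (h : Mel A₁ B₁ D L z = 0) : B₁ ∈ Set.uIcc (-(Dtil D L) * A₁) (-A₁) := by
  have hD0 : 0 < D := by linarith
  have hpos := Dtil_pos hD0 hL
  have hL1 := Dtil_mul_sinhRatio hD0 hL
  have hmono := (strictMonoOn_sinhRatio hD).monotoneOn
  rw [Mel_eq_zero_iff hD0 hL hz, ← sinhRatio_abs hD0.ne'] at h
  have hlo := hmono Set.self_mem_Ici (Set.mem_Ici.2 (abs_nonneg z)) (abs_nonneg z)
  have hhi := hmono (Set.mem_Ici.2 (abs_nonneg z)) (Set.mem_Ici.2 hL.le) hzL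
  rw [sinhRatio_zero] at hlo
  have h1 : Dtil D L ≤ Dtil D L * sinhRatio D |z| := le_mul_of_one_le_right hpos.le hlo
  have h2 : Dtil D L * sinhRatio D |z| ≤ 1 :=
    (mul_le_mul_of_nonneg_left hhi hpos.le).trans_eq hL1
  rw [Set.mem_uIcc]
  rcases le_total 0 A₁ with hA | hA
  · right; constructor <;> nlinarith
  · left; constructor <;> nlinarith

lemma exists_sinhRatio_eq {A₁ B₁ D L : ℝ} (hD : 0 < D) (hL : 0 < L)
    (hB : B₁ ∈ Set.Ioo (min (-(Dtil D L) * A₁) (-A₁)) (max (-(Dtil D L) * A₁) (-A₁))) :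
    ∃ z ∈ Set.Ioo 0 L, B₁ = -(Dtil D L) * A₁ * sinhRatio D z := by
  have h0 : -(Dtil D L) * A₁ * sinhRatio D 0 = -(Dtil D L) * A₁ := by
    rw [sinhRatio_zero, mul_one]
  have h1 : -(Dtil D L) * A₁ * sinhRatio D L = -A₁ := by
    linear_combination -A₁ * Dtil_mul_sinhRatio hD hL
  have hcont : Continuous fun z => -(Dtil D L) * A₁ * sinhRatio D z :=
    (continuous_sinhRatio D).const_mul _
  have hB' : B₁ ∈ Set.uIcc (-(Dtil D L) * A₁ * sinhRatio D 0)
      (-(Dtil D L) * A₁ * sinhRatio D L) := by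
    rw [h0, h1]
    exact Set.Ioo_subset_Icc_self hB
  obtain ⟨z, hz, hzB⟩ := intermediate_value_uIcc hcont.continuousOn hB'
  rw [Set.uIcc_of_le hL.le] at hz
  refine ⟨z, ⟨hz.1.lt_of_ne ?_, hz.2.lt_of_ne ?_⟩, hzB.symm⟩
  · rintro rfl
    have hBe : B₁ = -(Dtil D L) * A₁ := hzB.symm.trans h0
    rcases le_total (-(Dtil D L) * A₁) (-A₁) with h | h
    · exact (hB.1.trans_eq hBe).ne (min_eq_left h)
    · exact (hBe.symm.trans_lt hB.2).ne' (max_eq_left h)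
  · rintro rfl
    have hBe : B₁ = -A₁ := hzB.symm.trans h1
    rcases le_total (-(Dtil D z) * A₁) (-A₁) with h | h
    · exact (hBe.symm.trans_lt hB.2).ne' (max_eq_right h)
    · exact (hB.1.trans_eq hBe).ne (min_eq_right h)

lemma deriv_sinh_comb (a b c d L : ℝ) :
    deriv (fun x : ℝ => a * Real.sinh (c * (L - 2 * x)) + b * Real.sinh (d * (L - 2 * x))) =
      fun x => -2 * c * a * Real.cosh (c * (L - 2 * x)) +
        -2 * d * b * Real.cosh (d * (L - 2 * x)) := by
  ext x
  have hl (e : ℝ) : HasDerivAt (fun x : ℝ => e * (L - 2 * x)) (e * -(2 * 1)) x :=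
    (((hasDerivAt_id x).const_mul 2).const_sub L).const_mul e
  refine (((hl c).sinh.const_mul a).add ((hl d).sinh.const_mul b)).deriv.trans ?_
  ring

lemma deriv_cosh_comb (a b c d L : ℝ) :
    deriv (fun x : ℝ => a * Real.cosh (c * (L - 2 * x)) + b * Real.cosh (d * (L - 2 * x))) =
      fun x => -2 * c * a * Real.sinh (c * (L - 2 * x)) +
        -2 * d * b * Real.sinh (d * (L - 2 * x)) := by
  ext x
  have hl (e : ℝ) : HasDerivAt (fun x : ℝ => e * (L - 2 * x)) (e * -(2 * 1)) x :=
    (((hasDerivAt_id x).const_mul 2).const_sub L).const_mul e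
  refine (((hl c).cosh.const_mul a).add ((hl d).cosh.const_mul b)).deriv.trans ?_
  ring

lemma Mel_comp_eq_sinh_comb (A₁ B₁ D L : ℝ) :
    (fun x : ℝ => Mel A₁ B₁ D L (L - 2 * x)) = fun x =>
      A₁ / Real.sinh L * Real.sinh (1 * (L - 2 * x)) +
        B₁ / Real.sinh (L / D) * Real.sinh (D⁻¹ * (L - 2 * x)) := by
  ext x
  rw [Mel, one_mul, inv_mul_eq_div]
  ring

/-- Lemma 2.4 (case `C₁ = 0`): `x** = L/2` always solves the Melnikov condition; with
`B₁¹ = min(−D̃A₁, −A₁)` and `B₁² = max(−D̃A₁, −A₁)`, for `B₁ ∈ (B₁¹, B₁²)` there are exactly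
two further solutions in `(0, L)` symmetric about `L/2`; for `B₁ = −A₁ ≠ 0` the further
solutions are exactly `0` and `L`; for `B₁ = −D̃A₁`, `A₁ ≠ 0`, the root `L/2` of
`x ↦ M(L − 2x)` has multiplicity three; for `B₁ ∉ [B₁¹, B₁²]` there are no other solutions. -/
theorem melnikov_solutions_C_zero (D L A₁ B₁ : ℝ) (hD : 1 < D) (hL : 0 < L)
    (hAB : (A₁, B₁) ≠ (0, 0)) :
    (L / 2 ∈ MelSolSet A₁ B₁ D L) ∧
    (B₁ ∈ Set.Ioo (min (-(Dtil D L) * A₁) (-A₁)) (max (-(Dtil D L) * A₁) (-A₁)) →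
      ∃ x₁ ∈ Set.Ioo 0 (L / 2), MelSolSet A₁ B₁ D L = {x₁, L / 2, L - x₁}) ∧
    ((B₁ = -A₁ ∧ A₁ ≠ 0) → MelSolSet A₁ B₁ D L = {0, L / 2, L}) ∧
    ((B₁ = -(Dtil D L) * A₁ ∧ A₁ ≠ 0) →
      (fun x : ℝ => Mel A₁ B₁ D L (L - 2 * x)) (L / 2) = 0 ∧
      deriv (fun x : ℝ => Mel A₁ B₁ D L (L - 2 * x)) (L / 2) = 0 ∧
      deriv (deriv (fun x : ℝ => Mel A₁ B₁ D L (L - 2 * x))) (L / 2) = 0 ∧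
      deriv (deriv (deriv (fun x : ℝ => Mel A₁ B₁ D L (L - 2 * x)))) (L / 2) ≠ 0) ∧
    (B₁ ∉ Set.Icc (min (-(Dtil D L) * A₁) (-A₁)) (max (-(Dtil D L) * A₁) (-A₁)) →
      MelSolSet A₁ B₁ D L = {L / 2}) := by
  have hD0 : 0 < D := by linarith
  refine ⟨half_mem_MelSolSet A₁ B₁ D hL, fun hB => ?_, ?_, ?_, fun hB => ?_⟩
  · obtain ⟨z, ⟨hz, hzL⟩, hBz⟩ := exists_sinhRatio_eq hD0 hL hB
    have hA : A₁ ≠ 0 := by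
      rintro rfl
      simp at hB
    exact ⟨(L - z) / 2, ⟨by linarith, by linarith⟩,
      MelSolSet_eq_of_sinhRatio hD hA hz hzL.le hBz⟩
  · rintro ⟨hB, hA⟩
    have hBL : B₁ = -(Dtil D L) * A₁ * sinhRatio D L := by
      linear_combination hB + A₁ * Dtil_mul_sinhRatio hD0 hL
    simpa using MelSolSet_eq_of_sinhRatio hD hA hL le_rfl hBL
  · rintro ⟨hB, hA⟩
    have h1 : Real.sinh L ≠ 0 := Real.sinh_ne_zero.2 hL.ne'
    have h2 : Real.sinh (L / D) ≠ 0 := Real.sinh_ne_zero.2 (div_pos hL hD0).ne'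
    have hmid : L - 2 * (L / 2) = 0 := by ring
    have hb : B₁ / Real.sinh (L / D) = -(D * (A₁ / Real.sinh L)) := by
      rw [hB, Dtil]
      field_simp
    rw [Mel_comp_eq_sinh_comb, hb, deriv_sinh_comb, deriv_cosh_comb, deriv_sinh_comb]
    simp only [hmid, mul_zero, Real.sinh_zero, Real.cosh_zero, add_zero, mul_one, true_and]
    refine ⟨by field_simp; ring, fun h => ?_⟩
    have hsq : D ^ 2 - 1 = 0 := by
      field_simp at h
      refine mul_left_cancel₀ hA ?_
      linarith
    nlinarith
  · refine Set.eq_singleton_iff_unique_mem.2 ⟨half_mem_MelSolSet A₁ B₁ D hL, ?_⟩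
    rintro x ⟨⟨hx0, hxL⟩, hx⟩
    by_contra hne
    have hz : L - 2 * x ≠ 0 := fun h => hne (by linarith)
    exact hB (mem_uIcc_of_Mel_eq_zero hD hL hz (abs_le.2 ⟨by linarith, by linarith⟩) hx)
end

section
/- Let D > 1, L > 0 and B₁, C₁ ∈ ℝ be fixed. Then there exists A* > 0 such that for every A₁ with |A₁| > A*, the equation M(L − 2x) + C₁ = 0 has a unique solution x**(A₁) ∈ (0, L), and this solution satisfies x**(A₁) = L/2 + C₁ sinh(L)/(2A₁) + O(A₁⁻²) as |A₁| → ∞. Consequently, the value v** = sinh(L − 2x**(A₁))/sinh(L) of the slow variable at the transition satisfies v** = −C₁/A₁ + O(A₁⁻²) as |A₁| → ∞. -/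
open Real Set Filter Asymptotics

theorem abs_sinh_sub_self_le_sinh_sq (z : ℝ) : |Real.sinh z - z| ≤ Real.sinh z ^ 2 := by
  have hc : Real.cosh z - 1 ≤ Real.sinh z ^ 2 := by
    nlinarith [Real.cosh_sq z, Real.one_le_cosh z]
  have hs := Real.sinh_eq z
  have hch := Real.cosh_eq z
  rw [abs_le]
  constructor <;> linarith [Real.add_one_le_exp z, Real.add_one_le_exp (-z)]

theorem monotone_sinh_sub_sinh_div {D : ℝ} (hD : 1 ≤ D) :
    Monotone fun y : ℝ => Real.sinh y - Real.sinh (y / D) := by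
  have hder : ∀ y : ℝ, HasDerivAt (fun y : ℝ => Real.sinh y - Real.sinh (y / D))
      (Real.cosh y - Real.cosh (y / D) * (1 / D)) y := fun y =>
    (Real.hasDerivAt_sinh y).sub ((hasDerivAt_id y).div_const D).sinh
  refine monotone_of_deriv_nonneg (fun y => (hder y).differentiableAt) fun y => ?_
  rw [(hder y).deriv]
  have h1 : Real.cosh (y / D) ≤ Real.cosh y := by
    rw [Real.cosh_le_cosh, abs_div, abs_of_pos (by linarith : (0 : ℝ) < D)]
    exact div_le_self (abs_nonneg y) hD
  have h2 : Real.cosh (y / D) * (1 / D) ≤ Real.cosh (y / D) := by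
    rw [mul_one_div]
    exact div_le_self (Real.cosh_pos _).le hD
  linarith

theorem abs_sinh_div_sub_le {D : ℝ} (hD : 1 ≤ D) (z w : ℝ) :
    |Real.sinh (z / D) - Real.sinh (w / D)| ≤ |Real.sinh z - Real.sinh w| := by
  wlog h : w ≤ z generalizing z w
  · rw [abs_sub_comm, abs_sub_comm (Real.sinh z)]
    exact this w z (le_of_not_ge h)
  have hm := monotone_sinh_sub_sinh_div hD h
  have hd : Real.sinh (w / D) ≤ Real.sinh (z / D) :=
    Real.sinh_le_sinh.2 (div_le_div_of_nonneg_right h (by linarith))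
  rw [abs_of_nonneg (sub_nonneg.2 hd), abs_of_nonneg (sub_nonneg.2 (Real.sinh_le_sinh.2 h))]
  dsimp only at hm
  linarith

theorem abs_sinh_div_le {D : ℝ} (hD : 1 ≤ D) (z : ℝ) :
    |Real.sinh (z / D)| ≤ |Real.sinh z| := by
  simpa using abs_sinh_div_sub_le hD z 0

theorem Mel_injective {A B D L : ℝ} (hD : 1 ≤ D) (hL : 0 < L)
    (hA : |B / Real.sinh (L / D)| * Real.sinh L < |A|) :
    Function.Injective (Mel A B D L) := by
  intro z w h
  have hs : 0 < Real.sinh L := Real.sinh_pos_iff.2 hL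
  have hlt : |B / Real.sinh (L / D)| < |A / Real.sinh L| := by
    rwa [abs_div A, abs_of_pos hs, lt_div_iff₀ hs]
  have heq : A / Real.sinh L * (Real.sinh z - Real.sinh w) =
      -(B / Real.sinh (L / D) * (Real.sinh (z / D) - Real.sinh (w / D))) := by
    unfold Mel at h
    linear_combination h
  have habs := congrArg abs heq
  rw [abs_neg, abs_mul, abs_mul] at habs
  by_contra hne
  have hpos : 0 < |Real.sinh z - Real.sinh w| :=
    abs_pos.2 (sub_ne_zero.2 (Real.sinh_injective.ne hne))
  have := mul_le_mul_of_nonneg_left (abs_sinh_div_sub_le hD z w)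
    (abs_nonneg (B / Real.sinh (L / D)))
  have := mul_lt_mul_of_pos_right hlt hpos
  linarith

theorem exists_Mel_eq {A B C D L : ℝ} (hD : 0 < D) (hL : 0 < L) (hA : |B| + |C| < |A|) :
    ∃ z ∈ Ioo (-L) L, Mel A B D L z + C = 0 := by
  have hs : Real.sinh L ≠ 0 := (Real.sinh_pos_iff.2 hL).ne'
  have hs' : Real.sinh (L / D) ≠ 0 := (Real.sinh_pos_iff.2 (div_pos hL hD)).ne'
  have hr : Mel A B D L L = A + B := by
    unfold Mel
    field_simp
  have hl : Mel A B D L (-L) = -A - B := by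
    unfold Mel
    rw [neg_div, Real.sinh_neg, Real.sinh_neg]
    field_simp
    ring
  have hcont : ContinuousOn (fun z => Mel A B D L z + C) (Icc (-L) L) := by
    unfold Mel
    fun_prop
  have hle : -L ≤ L := by linarith
  have hB := abs_le.1 (le_refl |B|)
  have hC := abs_le.1 (le_refl |C|)
  rcases abs_cases A with ⟨hAA, _⟩ | ⟨hAA, _⟩
  · obtain ⟨z, hz, h⟩ := intermediate_value_Ioo hle hcont
      (show (0 : ℝ) ∈ Ioo (Mel A B D L (-L) + C) (Mel A B D L L + C) by
        rw [hr, hl]; constructor <;> linarith)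
    exact ⟨z, hz, h⟩
  · obtain ⟨z, hz, h⟩ := intermediate_value_Ioo' hle hcont
      (show (0 : ℝ) ∈ Ioo (Mel A B D L L + C) (Mel A B D L (-L) + C) by
        rw [hr, hl]; constructor <;> linarith)
    exact ⟨z, hz, h⟩

theorem abs_sinh_le_of_Mel_eq {A B C D L z : ℝ} (hD : 1 ≤ D) (hL : 0 < L) (hA₀ : A ≠ 0)
    (hA : 2 * (|B / Real.sinh (L / D)| * Real.sinh L) ≤ |A|) (hz : Mel A B D L z + C = 0) :
    |Real.sinh z| ≤ 2 * Real.sinh L * |C| / |A| := by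
  have hs : 0 < Real.sinh L := Real.sinh_pos_iff.2 hL
  have heq : A * Real.sinh z =
      -(Real.sinh L * (B / Real.sinh (L / D) * Real.sinh (z / D) + C)) := by
    unfold Mel at hz
    have h : A * Real.sinh z = A * Real.sinh z / Real.sinh L * Real.sinh L := by field_simp
    rw [h]
    linear_combination Real.sinh L * hz
  have habs := congrArg abs heq
  rw [abs_neg, abs_mul, abs_mul, abs_of_pos hs] at habs
  have h1 : |B / Real.sinh (L / D) * Real.sinh (z / D) + C| ≤
      |B / Real.sinh (L / D)| * |Real.sinh z| + |C| := by
    refine (abs_add_le _ _).trans ?_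
    rw [abs_mul]
    linarith [mul_le_mul_of_nonneg_left (abs_sinh_div_le hD z)
      (abs_nonneg (B / Real.sinh (L / D)))]
  have h2 := mul_le_mul_of_nonneg_left h1 hs.le
  have h3 := mul_le_mul_of_nonneg_right hA (abs_nonneg (Real.sinh z))
  rw [le_div_iff₀ (abs_pos.2 hA₀)]
  linarith

theorem abs_sinh_div_add_le_of_Mel_eq {A B C D L z : ℝ} (hD : 1 ≤ D) (hL : 0 < L) (hA₀ : A ≠ 0)
    (hA : 2 * (|B / Real.sinh (L / D)| * Real.sinh L) ≤ |A|) (hz : Mel A B D L z + C = 0) :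
    |Real.sinh z / Real.sinh L + C / A| ≤
      2 * Real.sinh L * |C| * |B / Real.sinh (L / D)| * (A ^ 2)⁻¹ := by
  have heq : Real.sinh z / Real.sinh L + C / A =
      -(B / Real.sinh (L / D) * Real.sinh (z / D)) / A := by
    unfold Mel at hz
    rw [eq_div_iff hA₀, add_mul, div_mul_cancel₀ _ hA₀]
    linear_combination hz
  rw [heq, abs_div, abs_neg, abs_mul]
  calc |B / Real.sinh (L / D)| * |Real.sinh (z / D)| / |A|
      ≤ |B / Real.sinh (L / D)| * (2 * Real.sinh L * |C| / |A|) / |A| := by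
        gcongr
        exact (abs_sinh_div_le hD z).trans (abs_sinh_le_of_Mel_eq hD hL hA₀ hA hz)
    _ = _ := by
        rw [← sq_abs A]
        field_simp

theorem abs_add_le_of_Mel_eq {A B C D L z : ℝ} (hD : 1 ≤ D) (hL : 0 < L) (hA₀ : A ≠ 0)
    (hA : 2 * (|B / Real.sinh (L / D)| * Real.sinh L) ≤ |A|) (hz : Mel A B D L z + C = 0) :
    |z + C * Real.sinh L / A| ≤
      ((2 * Real.sinh L * |C|) ^ 2 +
        Real.sinh L * (2 * Real.sinh L * |C| * |B / Real.sinh (L / D)|)) * (A ^ 2)⁻¹ := by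
  have hs : 0 < Real.sinh L := Real.sinh_pos_iff.2 hL
  have h1 : Real.sinh z ^ 2 ≤ (2 * Real.sinh L * |C|) ^ 2 * (A ^ 2)⁻¹ := by
    have h := pow_le_pow_left₀ (abs_nonneg _) (abs_sinh_le_of_Mel_eq hD hL hA₀ hA hz) 2
    rwa [sq_abs, div_pow, sq_abs, div_eq_mul_inv] at h
  have h2 := mul_le_mul_of_nonneg_left (abs_sinh_div_add_le_of_Mel_eq hD hL hA₀ hA hz) hs.le
  have heq : z + C * Real.sinh L / A = -(Real.sinh z - z) +
      Real.sinh L * (Real.sinh z / Real.sinh L + C / A) := by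
    field_simp
    ring
  rw [heq]
  refine (abs_add_le _ _).trans ?_
  rw [abs_neg, abs_mul, abs_of_pos hs]
  linarith [abs_sinh_sub_self_le_sinh_sq z]

/-- For `|A₁|` large (with `B₁, C₁` fixed), the Melnikov condition `M(L − 2x) + C₁ = 0` has a
unique solution `x**(A₁) ∈ (0, L)`, with `x**(A₁) = L/2 + C₁ sinh(L)/(2A₁) + O(A₁⁻²)` and
`v** = sinh(L − 2x**(A₁))/sinh(L) = −C₁/A₁ + O(A₁⁻²)` as `|A₁| → ∞`. -/
theorem melnikov_unique_solution_large_A (D L B₁ C₁ : ℝ) (hD : 1 < D) (hL : 0 < L) :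
    ∃ Abound > (0 : ℝ), ∃ xs : ℝ → ℝ,
      (∀ A₁ : ℝ, Abound < |A₁| →
        xs A₁ ∈ Set.Ioo 0 L ∧
        Mel A₁ B₁ D L (L - 2 * xs A₁) + C₁ = 0 ∧
        (∀ x ∈ Set.Ioo 0 L, Mel A₁ B₁ D L (L - 2 * x) + C₁ = 0 → x = xs A₁)) ∧
      (fun A₁ : ℝ => xs A₁ - (L / 2 + C₁ * Real.sinh L / (2 * A₁)))
        =O[Bornology.cobounded ℝ] (fun A₁ : ℝ => (A₁ ^ 2)⁻¹) ∧
      (fun A₁ : ℝ => Real.sinh (L - 2 * xs A₁) / Real.sinh L - (-C₁ / A₁))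
        =O[Bornology.cobounded ℝ] (fun A₁ : ℝ => (A₁ ^ 2)⁻¹) := by
  have hD' := hD.le
  have hs : 0 < Real.sinh L := Real.sinh_pos_iff.2 hL
  set b := |B₁ / Real.sinh (L / D)| * Real.sinh L with hb
  have hb0 : 0 ≤ b := by positivity
  set R := 2 * b + |B₁| + |C₁| + 1 with hR
  have hR0 : 0 < R := by positivity
  have hex : ∀ A : ℝ, ∃ z : ℝ, R < |A| → z ∈ Ioo (-L) L ∧ Mel A B₁ D L z + C₁ = 0 := by
    intro A
    by_cases h : R < |A|
    · obtain ⟨z, hz⟩ := exists_Mel_eq (A := A) (B := B₁) (C := C₁) (by linarith : 0 < D) hL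
        (by linarith)
      exact ⟨z, fun _ => hz⟩
    · exact ⟨0, fun h' => absurd h' h⟩
  choose z hz using hex
  have hzx : ∀ A, L - 2 * ((L - z A) / 2) = z A := fun A => by ring
  have hev : ∀ᶠ A : ℝ in Bornology.cobounded ℝ, R < |A| :=
    tendsto_norm_cobounded_atTop.eventually_gt_atTop R
  refine ⟨R, hR0, fun A => (L - z A) / 2, fun A hA => ?_, ?_, ?_⟩
  · obtain ⟨hmem, hzero⟩ := hz A hA
    refine ⟨⟨by linarith [hmem.2], by linarith [hmem.1]⟩, by rwa [hzx], fun x _ hx => ?_⟩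
    have hinj : Function.Injective (Mel A B₁ D L) := by
      apply Mel_injective hD' hL
      linarith [abs_nonneg B₁, abs_nonneg C₁]
    have := hinj (by linarith : Mel A B₁ D L (L - 2 * x) = Mel A B₁ D L (z A))
    linarith
  · refine IsBigO.of_bound ((2 * Real.sinh L * |C₁|) ^ 2 +
      Real.sinh L * (2 * Real.sinh L * |C₁| * |B₁ / Real.sinh (L / D)|))
      (hev.mono fun A hA => ?_)
    have hA₀ : A ≠ 0 := abs_pos.1 (hR0.trans hA)
    have h := abs_add_le_of_Mel_eq hD' hL hA₀
      (by linarith [abs_nonneg B₁, abs_nonneg C₁]) (hz A hA).2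
    have heq : (L - z A) / 2 - (L / 2 + C₁ * Real.sinh L / (2 * A)) =
        -((z A + C₁ * Real.sinh L / A) / 2) := by
      field_simp
      ring
    rw [Real.norm_eq_abs, heq, abs_neg, abs_div, abs_two,
      Real.norm_of_nonneg (by positivity : 0 ≤ (A ^ 2)⁻¹)]
    exact (half_le_self (abs_nonneg _)).trans h
  · refine IsBigO.of_bound (2 * Real.sinh L * |C₁| * |B₁ / Real.sinh (L / D)|)
      (hev.mono fun A hA => ?_)
    have hA₀ : A ≠ 0 := abs_pos.1 (hR0.trans hA)
    have h := abs_sinh_div_add_le_of_Mel_eq hD' hL hA₀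
      (by linarith [abs_nonneg B₁, abs_nonneg C₁]) (hz A hA).2
    rw [Real.norm_eq_abs, hzx, neg_div, sub_neg_eq_add,
      Real.norm_of_nonneg (by positivity : 0 ≤ (A ^ 2)⁻¹)]
    exact h
end

section
/- The function L_max(A₀) = 6 log((√6 + √(9A₀ − 2))/(√2 + √(9A₀ − 6))) is strictly decreasing on [2/3, ∞), satisfies L_max(A₀) → 0 as A₀ → ∞, and L_max(2/3) = 6 log(√2 + √3). -/
open Real Filter Set

/-- The maximal half-period `L_max(A₀) = 6 log((√6 + √(9A₀−2))/(√2 + √(9A₀−6)))`. -/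
noncomputable def Lmax (A₀ : ℝ) : ℝ :=
  6 * Real.log ((Real.sqrt 6 + Real.sqrt (9 * A₀ - 2)) /
    (Real.sqrt 2 + Real.sqrt (9 * A₀ - 6)))

theorem strictAntiOn_Lmax : StrictAntiOn Lmax (Set.Ici (2 / 3)) := by
  intro x hx y hy hxy
  rw [Set.mem_Ici] at hx hy
  have h2 : 0 < √(2 : ℝ) := by positivity
  have h26 : √(2 : ℝ) < √6 := Real.sqrt_lt_sqrt (by norm_num) (by norm_num)
  unfold Lmax
  have hp := Real.sq_sqrt (show (0 : ℝ) ≤ 9 * x - 2 by linarith)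
  have hq := Real.sq_sqrt (show (0 : ℝ) ≤ 9 * x - 6 by linarith)
  have hP := Real.sq_sqrt (show (0 : ℝ) ≤ 9 * y - 2 by linarith)
  have hQ := Real.sq_sqrt (show (0 : ℝ) ≤ 9 * y - 6 by linarith)
  have hp0 := Real.sqrt_nonneg (9 * x - 2)
  have hq0 := Real.sqrt_nonneg (9 * x - 6)
  have hP0 := Real.sqrt_nonneg (9 * y - 2)
  have hQ0 := Real.sqrt_nonneg (9 * y - 6)
  have hqQ : √(9 * x - 6) < √(9 * y - 6) := Real.sqrt_lt_sqrt (by linarith) (by linarith)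
  set p := √(9 * x - 2)
  set q := √(9 * x - 6)
  set P := √(9 * y - 2)
  set Q := √(9 * y - 6)
  have hcross : P * q < p * Q := by
    refine lt_of_pow_lt_pow_left₀ 2 (by positivity) ?_
    rw [mul_pow, mul_pow, hP, hq, hp, hQ]
    nlinarith
  have hqp : q < p := lt_of_pow_lt_pow_left₀ 2 hp0 (by linarith)
  have hQP : Q < P := lt_of_pow_lt_pow_left₀ 2 hP0 (by linarith)
  have hdiff : P - p ≤ Q - q := by
    by_contra! h
    have : (Q - q) * (Q + q) = (P - p) * (P + p) := by linarith
    nlinarith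
  have h1 : √2 * (P - p) ≤ √2 * (Q - q) := mul_le_mul_of_nonneg_left hdiff h2.le
  have h3 : √2 * (Q - q) < √6 * (Q - q) := mul_lt_mul_of_pos_right h26 (by linarith)
  refine mul_lt_mul_of_pos_left (Real.log_lt_log (by positivity) ?_) (by norm_num)
  rw [div_lt_div_iff₀ (by positivity) (by positivity)]
  linarith

theorem tendsto_Lmax_atTop : Tendsto Lmax atTop (nhds 0) := by
  have hden : Tendsto (fun x : ℝ => √2 + √(9 * x - 6)) atTop atTop :=
    tendsto_atTop_add_const_left _ _ (Real.tendsto_sqrt_atTop.comp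
      (tendsto_atTop_add_const_right _ (-6)
        (tendsto_id.const_mul_atTop (show (0 : ℝ) < 9 by norm_num))))
  have hupper : Tendsto (fun x : ℝ => 1 + (√6 - √2 + 2) / (√2 + √(9 * x - 6)))
      atTop (nhds 1) := by
    simpa using (hden.const_div_atTop (√6 - √2 + 2)).const_add 1
  have h26 : √(2 : ℝ) ≤ √6 := Real.sqrt_le_sqrt (by norm_num)
  have hratio : Tendsto (fun x : ℝ => (√6 + √(9 * x - 2)) / (√2 + √(9 * x - 6)))
      atTop (nhds 1) := by
    refine tendsto_of_tendsto_of_tendsto_of_le_of_le' tendsto_const_nhds hupper ?_ ?_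
    · filter_upwards with x
      rw [le_div_iff₀ (by positivity), one_mul]
      exact add_le_add h26 (Real.sqrt_le_sqrt (by linarith))
    · filter_upwards [eventually_ge_atTop 1] with x hx
      have hp : √(9 * x - 2) ≤ √(9 * x - 6) + 2 := by
        rw [Real.sqrt_le_left (by positivity)]
        nlinarith [Real.sq_sqrt (show (0 : ℝ) ≤ 9 * x - 6 by linarith),
          Real.sqrt_nonneg (9 * x - 6)]
      have hd : 0 < √2 + √(9 * x - 6) := by positivity
      rw [div_le_iff₀ hd, add_mul, div_mul_cancel₀ _ hd.ne']
      linarith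
  change Tendsto (fun x => Lmax x) atTop (nhds 0)
  simpa [Lmax] using (hratio.log one_ne_zero).const_mul 6

theorem Lmax_two_thirds : Lmax (2 / 3) = 6 * Real.log (√2 + √3) := by
  have h6 : √(6 : ℝ) = √2 * √3 := by
    rw [← Real.sqrt_mul (by norm_num)]
    norm_num
  have h4 : √(9 * (2 / 3) - 2 : ℝ) = √2 * √2 := by
    rw [← Real.sqrt_mul (by norm_num)]
    norm_num
  have h0 : √(9 * (2 / 3) - 6 : ℝ) = 0 := by norm_num
  rw [Lmax, h6, h4, h0, add_zero, ← mul_add, mul_div_cancel_left₀ _ (by positivity), add_comm √3]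

/-- `L_max` is strictly decreasing on `[2/3, ∞)`, tends to `0` as `A₀ → ∞`, and
`L_max(2/3) = 6 log(√2 + √3)`. -/
theorem Lmax_properties :
    StrictAntiOn Lmax (Set.Ici (2 / 3)) ∧
    Tendsto Lmax atTop (nhds 0) ∧
    Lmax (2 / 3) = 6 * Real.log (Real.sqrt 2 + Real.sqrt 3) :=
  ⟨strictAntiOn_Lmax, tendsto_Lmax_atTop, Lmax_two_thirds⟩
end
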